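/- It holds that P(1 − φ) + 2φ·ξ(2φ) ≥ R. -/

import Mathlib

open Real

noncomputable def R : ℝ := 1 / (1 + Real.log 2)

noncomputable def f (x : ℝ) : ℝ :=
  if x ≤ R then 1/2 else (2 * Real.exp 1) ^ (x - 1)

noncomputable def F (x : ℝ) : ℝ :=
  if x ≤ R then x/2 else R * (2 * Real.exp 1) ^ (x - 1)

noncomputable def P (c : ℝ) : ℝ := ∫ y in (0:ℝ)..1, min (f y) c

noncomputable def Q (c : ℝ) : ℝ := ∫ y in (0:ℝ)..1, max (c - f y) 0

noncomputable def xic : ℝ := (1 + (2/3) * Real.log (4/3)) * R - 2/3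

noncomputable def phi : ℝ := (2/3) * xic / (2/3 - R + xic)

noncomputable def xi (x : ℝ) : ℝ :=
  if x ≤ 1/3 then xic / x else 9 * xic * (1 - 2 * x)

noncomputable def T (a b : ℝ) : ℝ := (a + b - 1/2) * (xi b - xi a)

noncomputable def pile (x : ℝ) : ℝ := max (2/3) (2 * x)

lemma R_bounds : 0.59061610 < R ∧ R < 0.59061612 := by
  have h1 := Real.log_two_gt_d9
  have h2 := Real.log_two_lt_d9
  unfold R
  constructor
  · rw [lt_div_iff₀ (by linarith)]; linarith
  · rw [div_lt_iff₀ (by linarith)]; linarith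

lemma xic_bounds : 0.037222 < xic ∧ xic < 0.037223 := by
  obtain ⟨h1, h2⟩ := R_bounds
  have h3 := Real.log_two_gt_d9
  have h4 := Real.log_two_lt_d9
  have h5 := Real.log_three_gt_d9
  have h6 := Real.log_three_lt_d9
  have h : Real.log (4 / 3) = 2 * Real.log 2 - Real.log 3 := by
    rw [Real.log_div (by norm_num) (by norm_num), show (4 : ℝ) = 2 ^ 2 by norm_num, Real.log_pow]
    norm_num
  have hl : 0.28768207 < Real.log (4 / 3) := by rw [h]; linarith
  have hu : Real.log (4 / 3) < 0.28768208 := by rw [h]; linarith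
  unfold xic
  constructor
  · nlinarith [mul_pos (sub_pos.2 hl) (sub_pos.2 h1)]
  · nlinarith [mul_pos (sub_pos.2 hu) (show 0 < R by linarith)]

lemma phi_bounds : 0.21907 < phi ∧ phi < 0.21908 := by
  obtain ⟨h1, h2⟩ := R_bounds
  obtain ⟨h3, h4⟩ := xic_bounds
  unfold phi
  constructor
  · rw [lt_div_iff₀ (by linarith)]; linarith
  · rw [div_lt_iff₀ (by linarith)]; linarith

lemma two_mul_exp_one_rpow (x : ℝ) : (2 * Real.exp 1) ^ x = Real.exp (x / R) := by
  rw [Real.rpow_def_of_pos (by positivity), Real.log_mul (by norm_num) (by positivity),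
    Real.log_exp, R, div_div_eq_mul_div, div_one]
  ring_nf

lemma exp_R_sub_one_div_R : Real.exp ((R - 1) / R) = 1 / 2 := by
  have hR : R ≠ 0 := by linarith [R_bounds.1]
  have hinv : 1 / R = 1 + Real.log 2 := by rw [R, one_div_one_div]
  rw [sub_div, div_self hR, hinv, sub_add_cancel_left, Real.exp_neg,
    Real.exp_log (by norm_num), one_div]

lemma f_eq_max (x : ℝ) : f x = max (1 / 2) (Real.exp ((x - 1) / R)) := by
  have hR : 0 < R := by linarith [R_bounds.1]
  unfold f
  split_ifs with h
  · rw [max_eq_left]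
    rw [← exp_R_sub_one_div_R]
    gcongr
  · rw [two_mul_exp_one_rpow, max_eq_right]
    rw [← exp_R_sub_one_div_R]
    have := (not_le.1 h).le
    gcongr

lemma P_eq {c : ℝ} (hc : 1 / 2 ≤ c) (hc1 : c ≤ 1) : P c = R * c * (1 - Real.log c) := by
  have hR : 0 < R := by linarith [R_bounds.1]
  have hc0 : 0 < c := by linarith
  set t := 1 + R * Real.log c with ht
  have hct : Real.exp ((t - 1) / R) = c := by
    rw [ht, add_sub_cancel_left, mul_div_cancel_left₀ _ hR.ne', Real.exp_log hc0]
  have hRt : R ≤ t := by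
    have h : Real.exp ((R - 1) / R) ≤ Real.exp ((t - 1) / R) := by
      rw [exp_R_sub_one_div_R, hct]; exact hc
    rw [Real.exp_le_exp, div_le_div_iff_of_pos_right hR] at h
    linarith
  have ht1 : t ≤ 1 := by
    have := mul_nonneg hR.le (neg_nonneg.2 (Real.log_nonpos hc0.le hc1))
    linarith
  have hcont : Continuous fun y => min (f y) c := by
    simp only [f_eq_max]
    fun_prop
  have hint (a b : ℝ) : IntervalIntegrable (fun y => min (f y) c) MeasureTheory.volume a b :=
    hcont.intervalIntegrable a b
  have h₁ : ∫ y in (0 : ℝ)..R, min (f y) c = R / 2 := by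
    rw [intervalIntegral.integral_congr (g := fun _ => 1 / 2)]
    · simp [div_eq_mul_inv]
    · intro y hy
      rw [Set.uIcc_of_le hR.le] at hy
      simp only [f, if_pos hy.2, min_eq_left hc]
  have h₂ : ∫ y in R..t, min (f y) c = R * (c - 1 / 2) := by
    rw [intervalIntegral.integral_congr (g := fun y => Real.exp ((y - 1) / R)),
      intervalIntegral.integral_eq_sub_of_hasDerivAt
        (f := fun y => R * Real.exp ((y - 1) / R))]
    · rw [hct, exp_R_sub_one_div_R]; ring
    · intro y _
      have h := ((((hasDerivAt_id' y).sub_const 1).div_const R).exp).const_mul R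
      rwa [mul_left_comm, mul_one_div_cancel hR.ne', mul_one] at h
    · exact (by fun_prop : Continuous fun y => Real.exp ((y - 1) / R)).intervalIntegrable _ _
    · intro y hy
      rw [Set.uIcc_of_le hRt] at hy
      have hl : 1 / 2 ≤ Real.exp ((y - 1) / R) := by
        rw [← exp_R_sub_one_div_R]
        have := hy.1
        gcongr
      have hu : Real.exp ((y - 1) / R) ≤ c := by
        rw [← hct]
        have := hy.2
        gcongr
      simp only [f_eq_max, max_eq_right hl, min_eq_left hu]
  have h₃ : ∫ y in t..1, min (f y) c = (1 - t) * c := by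
    rw [intervalIntegral.integral_congr (g := fun _ => c)]
    · simp
    · intro y hy
      rw [Set.uIcc_of_le ht1] at hy
      have hl : c ≤ Real.exp ((y - 1) / R) := by
        conv_lhs => rw [← hct]
        have := hy.1
        gcongr
      simp only [f_eq_max, min_eq_right (hl.trans (le_max_right _ _))]
  rw [P, ← intervalIntegral.integral_add_adjacent_intervals (hint 0 R) (hint R 1),
    ← intervalIntegral.integral_add_adjacent_intervals (hint R t) (hint t 1), h₁, h₂, h₃, ht]
  ring

theorem stmt_13 : P (1 - phi) + 2 * phi * xi (2 * phi) ≥ R := by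
  obtain ⟨hR₁, hR₂⟩ := R_bounds
  obtain ⟨hx₁, hx₂⟩ := xic_bounds
  obtain ⟨hp₁, hp₂⟩ := phi_bounds
  have hlog0 : Real.log (25 / 32) < -0.24686 := by
    rw [Real.log_div (by norm_num) (by norm_num), show (25 : ℝ) = 5 ^ 2 by norm_num,
      show (32 : ℝ) = 2 ^ 5 by norm_num, Real.log_pow, Real.log_pow]
    have := Real.log_five_lt_d9
    have := Real.log_two_gt_d9
    push_cast
    linarith
  have hlog : Real.log (1 - phi) < -0.24726 := by
    have h := Real.log_le_sub_one_of_pos (x := (1 - phi) / (25 / 32))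
      (div_pos (by linarith) (by norm_num))
    rw [Real.log_div (by linarith) (by norm_num)] at h
    linarith
  have hprod : 0.78092 * 1.24726 ≤ (1 - phi) * (1 - Real.log (1 - phi)) :=
    mul_le_mul (by linarith) (by linarith) (by norm_num) (by linarith)
  have hP : R - 0.0154 ≤ P (1 - phi) := by
    rw [P_eq (by linarith) (by linarith), mul_assoc]
    nlinarith [mul_le_mul_of_nonneg_left hprod (show 0 ≤ R by linarith)]
  have hxi : 0.0154 ≤ 2 * phi * xi (2 * phi) := by
    rw [xi, if_neg (by linarith)]
    have h₁ : 0.21907 * 0.037222 ≤ phi * xic :=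
      mul_le_mul hp₁.le hx₁.le (by norm_num) (by linarith)
    have h₂ : 0.21907 * 0.037222 * 0.12368 ≤ phi * xic * (1 - 2 * (2 * phi)) :=
      mul_le_mul h₁ (by linarith) (by norm_num) (h₁.trans' (by norm_num))
    linarith
  linarith
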